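/- For any finite set A ⊆ ℝ with 0, ±1 ∉ A, E_2(A) ≤ C · |A(A+1)|^{2/3} |A|^{1/3} E_{1.5}(A)^{2/3}, where E_2(A) is the multiplicative energy of A (the number of quadruples (a,b,c,d) ∈ A⁴ with ab = cd) and E_{1.5}(A) = Σ_{x ∈ A/A} |A ∩ xA^{−1}|^{3/2}. -/

import Mathlib

open Finset

/-- `E_{1.5}(A)`: sum over products `s` of (number of representations `s = a·b`)^{3/2}. -/
noncomputable def E₁₅ (A : Finset ℝ) : ℝ :=
  ∑ s ∈ Finset.image₂ (· * ·) A A,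
    (((A ×ˢ A).filter (fun q => q.1 * q.2 = s)).card : ℝ) ^ ((3 : ℝ) / 2)

/-- `E_2(A)`: number of quadruples `(a,b,c,d) ∈ A⁴` with `a·b = c·d`. -/
noncomputable def E₂ (A : Finset ℝ) : ℕ :=
  (((A ×ˢ A) ×ˢ (A ×ˢ A)).filter (fun q => q.1.1 * q.1.2 = q.2.1 * q.2.2)).card

/-- Rank of `x` in `X`. -/
noncomputable def rk (X : Finset ℝ) (x : ℝ) : ℕ := (X.filter (· < x)).card

lemma rk_mono (X : Finset ℝ) : Monotone (rk X) := by
  intro x y h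
  apply Finset.card_le_card
  intro z hz
  simp only [Finset.mem_filter] at *
  exact ⟨hz.1, hz.2.trans_le h⟩

lemma rk_strict (X : Finset ℝ) {x y : ℝ} (hx : x ∈ X) (h : x < y) : rk X x < rk X y := by
  apply Finset.card_lt_card
  rw [Finset.ssubset_iff_of_subset]
  · exact ⟨x, by simp [hx, h], by simp⟩
  · intro z hz
    simp only [Finset.mem_filter] at *
    exact ⟨hz.1, hz.2.trans h⟩

lemma rk_lt (X : Finset ℝ) {x : ℝ} (hx : x ∈ X) : rk X x < X.card := by
  apply Finset.card_lt_card
  rw [Finset.ssubset_iff_of_subset (Finset.filter_subset _ _)]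
  exact ⟨x, hx, by simp⟩

lemma rk_inj (X : Finset ℝ) : Set.InjOn (rk X) X := by
  intro x hx y hy h
  rcases lt_trichotomy x y with h1 | h1 | h1
  · exact absurd h (rk_strict X hx h1).ne
  · exact h1
  · exact absurd h (rk_strict X hy h1).ne'

/-- Block index of `x` when `X` is cut into at most `t` consecutive blocks. -/
noncomputable def blk (X : Finset ℝ) (t : ℕ) (x : ℝ) : ℕ := rk X x / (X.card / t + 1)

lemma blk_mono (X : Finset ℝ) (t : ℕ) : Monotone (blk X t) := fun _ _ h =>
  Nat.div_le_div_right (rk_mono X h)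

lemma blk_lt (X : Finset ℝ) {t : ℕ} (ht : 0 < t) {x : ℝ} (hx : x ∈ X) : blk X t x < t := by
  unfold blk
  rw [Nat.div_lt_iff_lt_mul (by positivity)]
  have h1 := rk_lt X hx
  have h2 := Nat.lt_mul_div_succ X.card ht
  exact h1.trans h2

lemma blk_card (X : Finset ℝ) (t k : ℕ) :
    (X.filter (fun x => blk X t x = k)).card ≤ X.card / t + 1 := by
  set p := X.card / t + 1 with hp
  have : (X.filter (fun x => blk X t x = k)).card ≤ (Finset.Ico (k * p) (k * p + p)).card := by
    apply Finset.card_le_card_of_injOn (rk X)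
    · intro x hx
      simp only [Finset.coe_filter, Set.mem_ofPred_eq] at hx
      have h := hx.2
      unfold blk at h
      rw [← hp] at h
      simp only [Finset.coe_Ico, Set.mem_Ico]
      subst h
      have h1 := Nat.div_mul_le_self (rk X x) p
      have h2 := Nat.lt_div_mul_add (a := rk X x) (b := p) (by rw [hp]; exact Nat.succ_pos _)
      exact ⟨h1, h2⟩
    · exact (rk_inj X).mono (by intro x hx; simp at hx; exact hx.1)
  simpa using this

/-- incidences between the grid `X × Y` and the lines `y = l.1 x + l.2`. -/
noncomputable def inc (X Y : Finset ℝ) (Λ : Finset (ℝ × ℝ)) : Finset ((ℝ × ℝ) × (ℝ × ℝ)) :=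
  ((X ×ˢ Y) ×ˢ Λ).filter (fun q => q.1.2 = q.2.1 * q.1.1 + q.2.2)

noncomputable abbrev cellOf (X Y : Finset ℝ) (t : ℕ) (q : (ℝ × ℝ) × (ℝ × ℝ)) :
    (ℝ × ℝ) × (ℕ × ℕ) := (q.2, (blk X t q.1.1, blk Y t q.1.2))

lemma cells_card (X Y : Finset ℝ) (Λ : Finset (ℝ × ℝ)) (hΛ : ∀ l ∈ Λ, l.1 ≠ 0) (t : ℕ)
    (ht : 0 < t) : ((inc X Y Λ).image (cellOf X Y t)).card ≤ Λ.card * (2 * t) := by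
  classical
  have : ((inc X Y Λ).image (cellOf X Y t)).card ≤ (Λ ×ˢ Finset.range (2 * t)).card := by
    apply Finset.card_le_card_of_injOn
      (fun c => (c.1, if 0 < c.1.1 then c.2.1 + c.2.2 else c.2.1 + (t - 1 - c.2.2)))
    · intro c hc
      simp only [Finset.coe_image, Set.mem_image, Finset.mem_coe] at hc
      obtain ⟨⟨⟨x, y⟩, l⟩, hq, rfl⟩ := hc
      simp only [inc, Finset.mem_filter, Finset.mem_product] at hq
      have h1 := blk_lt X ht hq.1.1.1
      have h2 := blk_lt Y ht hq.1.1.2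
      simp only [cellOf, Finset.coe_product, Set.mem_prod, Finset.mem_coe, Finset.mem_range]
      refine ⟨hq.1.2, ?_⟩
      split_ifs <;> omega
    · intro c hc c' hc' h
      simp only [Finset.coe_image, Set.mem_image, Finset.mem_coe] at hc hc'
      obtain ⟨⟨⟨x, y⟩, l⟩, hq, rfl⟩ := hc
      obtain ⟨⟨⟨x', y'⟩, l'⟩, hq', rfl⟩ := hc'
      simp only [inc, Finset.mem_filter, Finset.mem_product] at hq hq'
      simp only [cellOf, Prod.mk.injEq] at h ⊢
      obtain ⟨rfl, h⟩ := h
      obtain ⟨⟨⟨hx, hy⟩, hl⟩, e⟩ := hq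
      obtain ⟨⟨⟨hx', hy'⟩, -⟩, e'⟩ := hq'
      have a1 := blk_lt X ht hx
      have a2 := blk_lt Y ht hy
      have a3 := blk_lt X ht hx'
      have a4 := blk_lt Y ht hy'
      refine ⟨rfl, ?_⟩
      by_cases hs : 0 < l.1
      · rw [if_pos hs, if_pos hs] at h
        rcases le_total x x' with hxx | hxx
        · have hyy : y ≤ y' := by rw [e, e']; gcongr
          have b1 := blk_mono X t hxx
          have b2 := blk_mono Y t hyy
          omega
        · have hyy : y' ≤ y := by rw [e, e']; gcongr
          have b1 := blk_mono X t hxx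
          have b2 := blk_mono Y t hyy
          omega
      · rw [if_neg hs, if_neg hs] at h
        have hs' : l.1 ≤ 0 := not_lt.1 hs
        rcases le_total x x' with hxx | hxx
        · have hyy : y' ≤ y := by
            rw [e, e']; have := mul_le_mul_of_nonpos_left hxx hs'; linarith
          have b1 := blk_mono X t hxx
          have b2 := blk_mono Y t hyy
          omega
        · have hyy : y ≤ y' := by
            rw [e, e']; have := mul_le_mul_of_nonpos_left hxx hs'; linarith
          have b1 := blk_mono X t hxx
          have b2 := blk_mono Y t hyy
          omega
  simpa [Finset.card_product] using this

lemma pairs_card (X Y : Finset ℝ) (t : ℕ) :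
    (((X ×ˢ Y) ×ˢ (X ×ˢ Y)).filter (fun q => blk X t q.2.1 = blk X t q.1.1 ∧
      blk Y t q.2.2 = blk Y t q.1.2)).card ≤
      (X.card * Y.card) * ((X.card / t + 1) * (Y.card / t + 1)) := by
  classical
  rw [Finset.card_filter, Finset.sum_product, ← Finset.card_product, ← smul_eq_mul]
  apply Finset.sum_le_card_nsmul
  intro p _
  rw [← Finset.card_filter]
  dsimp only
  rw [Finset.filter_product (fun x => blk X t x = blk X t p.1) (fun y => blk Y t y = blk Y t p.2),
    Finset.card_product]
  exact Nat.mul_le_mul (blk_card _ _ _) (blk_card _ _ _)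

lemma energy_card (X Y : Finset ℝ) (Λ : Finset (ℝ × ℝ)) (t : ℕ) :
    (((inc X Y Λ) ×ˢ (inc X Y Λ)).filter (fun q => cellOf X Y t q.1 = cellOf X Y t q.2)).card ≤
      (inc X Y Λ).card + (X.card * Y.card) * ((X.card / t + 1) * (Y.card / t + 1)) := by
  classical
  set T := inc X Y Λ with hT
  rw [← Finset.card_filter_add_card_filter_not (fun q => q.1 = q.2)]
  apply Nat.add_le_add
  · apply Finset.card_le_card_of_injOn (fun q => q.1)
    · intro q hq
      simp only [Finset.coe_filter, Finset.mem_filter, Finset.mem_product, Set.mem_ofPred_eq] at hq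
      exact hq.1.1.1
    · rintro ⟨q1, q2⟩ hq ⟨q1', q2'⟩ hq' h
      simp only [Finset.coe_filter, Finset.mem_filter, Finset.mem_product, Set.mem_ofPred_eq]
        at hq hq' h
      rw [Prod.mk.injEq, ← hq.2, ← hq'.2]
      exact ⟨h, h⟩
  · refine le_trans ?_ (pairs_card X Y t)
    apply Finset.card_le_card_of_injOn (fun q => (q.1.1, q.2.1))
    · rintro ⟨⟨⟨x, y⟩, l⟩, ⟨⟨x', y'⟩, l'⟩⟩ hq
      simp only [hT, inc, cellOf, Finset.coe_filter, Finset.mem_filter, Finset.mem_product,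
        Set.mem_ofPred_eq, Prod.mk.injEq] at hq ⊢
      obtain ⟨⟨⟨⟨h1, e1⟩, ⟨h2, e2⟩⟩, h3, h4, h5⟩, h6⟩ := hq
      exact ⟨⟨h1.1, h2.1⟩, h4.symm, h5.symm⟩
    · rintro ⟨⟨⟨x, y⟩, l⟩, ⟨⟨x', y'⟩, l'⟩⟩ hq ⟨⟨⟨u, v⟩, k⟩, ⟨⟨u', v'⟩, k'⟩⟩ hq' h
      simp only [hT, inc, cellOf, Finset.coe_filter, Finset.mem_filter, Finset.mem_product,
        Set.mem_ofPred_eq, Prod.mk.injEq] at hq hq' h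
      obtain ⟨⟨⟨⟨h1, e1⟩, ⟨h2, e2⟩⟩, h3, h4, h5⟩, h6⟩ := hq
      obtain ⟨⟨⟨⟨g1, f1⟩, ⟨g2, f2⟩⟩, g3, g4, g5⟩, g6⟩ := hq'
      obtain ⟨⟨rfl, rfl⟩, rfl, rfl⟩ := h
      subst h3 g3
      have hx : x ≠ x' := by
        rintro rfl
        apply h6
        simp [e1, e2]
      have hs : l.1 = k.1 := by
        have : (l.1 - k.1) * (x - x') = 0 := by linarith
        rcases mul_eq_zero.1 this with h | h
        · linarith
        · exact absurd (by linarith) hx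
      have hs2 : l.2 = k.2 := by rw [hs] at e1; linarith
      have : l = k := Prod.ext hs hs2
      subst this
      rfl

lemma cauchy_fib {α β : Type*} [DecidableEq α] [DecidableEq β] (T : Finset α) (g : α → β) :
    T.card ^ 2 ≤ (T.image g).card * ((T ×ˢ T).filter (fun q => g q.1 = g q.2)).card := by
  have h1 : T.card = ∑ b ∈ T.image g, (T.filter (fun a => g a = b)).card :=
    Finset.card_eq_sum_card_image g T
  have h2 : ((T ×ˢ T).filter (fun q => g q.1 = g q.2)).card =
      ∑ b ∈ T.image g, (T.filter (fun a => g a = b)).card ^ 2 := by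
    rw [Finset.card_eq_sum_card_fiberwise (f := fun q => g q.1) (t := T.image g)]
    · apply Finset.sum_congr rfl
      intro b _
      rw [sq, ← Finset.card_product]
      congr 1
      ext ⟨x, y⟩
      simp only [Finset.mem_filter, Finset.mem_product]
      constructor
      · rintro ⟨⟨⟨h1, h2⟩, h3⟩, h4⟩
        exact ⟨⟨h1, h4⟩, h2, h3 ▸ h4⟩
      · rintro ⟨⟨h1, h2⟩, h3, h4⟩
        exact ⟨⟨⟨h1, h3⟩, h2.trans h4.symm⟩, h2⟩
    · intro q hq
      simp only [Finset.coe_filter, Finset.mem_product, Set.mem_ofPred_eq] at hq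
      exact Finset.mem_coe.2 (Finset.mem_image_of_mem g hq.1.1)
  rw [h2]
  conv_lhs => rw [h1]
  exact sq_sum_le_card_mul_sum_sq

lemma grid_ST (X Y : Finset ℝ) (Λ : Finset (ℝ × ℝ)) (hΛ : ∀ l ∈ Λ, l.1 ≠ 0) (t : ℕ)
    (ht : 0 < t) (hX : t ≤ X.card) (hY : t ≤ Y.card) :
    ((inc X Y Λ).card : ℝ) ^ 2 ≤ 2 * Λ.card * t *
      ((inc X Y Λ).card + 4 * ((X.card : ℝ) * Y.card) ^ 2 / t ^ 2) := by
  classical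
  have h1 := cauchy_fib (inc X Y Λ) (cellOf X Y t)
  have h2 := cells_card X Y Λ hΛ t ht
  have h3 := energy_card X Y Λ t
  have h4 := h1.trans (Nat.mul_le_mul h2 h3)
  have h5 : ((inc X Y Λ).card : ℝ) ^ 2 ≤ Λ.card * (2 * t) * ((inc X Y Λ).card +
    (X.card * Y.card) * (((X.card / t : ℕ) + 1) * ((Y.card / t : ℕ) + 1))) := by exact_mod_cast h4
  have ht' : (0 : ℝ) < t := by exact_mod_cast ht
  have aux : ∀ n : ℕ, t ≤ n → ((n / t : ℕ) : ℝ) + 1 ≤ 2 * n / t := by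
    intro n hn
    have e1 : ((n / t : ℕ) : ℝ) ≤ n / t := Nat.cast_div_le
    have e2 : (1 : ℝ) ≤ n / t := by
      rw [le_div_iff₀ ht', one_mul]; exact_mod_cast hn
    have : 2 * (n : ℝ) / t = n / t + n / t := by ring
    linarith
  refine h5.trans ?_
  have e : 2 * (Λ.card : ℝ) * t * ((inc X Y Λ).card + 4 * ((X.card : ℝ) * Y.card) ^ 2 / t ^ 2)
    = Λ.card * (2 * t) * ((inc X Y Λ).card +
    (X.card * Y.card) * ((2 * X.card / t) * (2 * Y.card / t))) := by
    field_simp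
    ring
  rw [e]
  have := aux _ hX
  have := aux _ hY
  gcongr

/-- multiplicity of a product -/
noncomputable def rp (A : Finset ℝ) (s : ℝ) : ℕ :=
  ((A ×ˢ A).filter (fun q => q.1 * q.2 = s)).card

lemma rp_le (A : Finset ℝ) (h0 : (0 : ℝ) ∉ A) (s : ℝ) : rp A s ≤ A.card := by
  apply Finset.card_le_card_of_injOn (fun q => q.1)
  · intro q hq
    simp only [Finset.coe_filter, Finset.mem_product, Set.mem_ofPred_eq] at hq
    exact hq.1.1
  · rintro ⟨a, b⟩ hq ⟨a', b'⟩ hq' h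
    simp only [Finset.coe_filter, Finset.mem_product, Set.mem_ofPred_eq] at hq hq' h
    subst h
    have ha : a ≠ 0 := fun h => h0 (h ▸ hq.1.1)
    have : b = b' := mul_left_cancel₀ ha (hq.2.trans hq'.2.symm)
    rw [this]

lemma sum_rp (A : Finset ℝ) : ∑ s ∈ Finset.image₂ (· * ·) A A, rp A s = A.card ^ 2 := by
  rw [sq, ← Finset.card_product]
  symm
  apply Finset.card_eq_sum_card_fiberwise
  intro q hq
  simp only [Finset.coe_product, Set.mem_prod, Finset.mem_coe] at hq
  exact Finset.mem_coe.2 (Finset.mem_image₂_of_mem hq.1 hq.2)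

lemma E₂_eq (A : Finset ℝ) : E₂ A = ∑ s ∈ Finset.image₂ (· * ·) A A, rp A s ^ 2 := by
  unfold E₂
  rw [Finset.card_eq_sum_card_fiberwise (f := fun q => q.1.1 * q.1.2)
    (t := Finset.image₂ (· * ·) A A)]
  · apply Finset.sum_congr rfl
    intro b _
    rw [rp, sq, ← Finset.card_product]
    congr 1
    ext ⟨x, y⟩
    simp only [Finset.mem_filter, Finset.mem_product]
    constructor
    · rintro ⟨⟨⟨h1, h2⟩, h3⟩, h4⟩
      exact ⟨⟨h1, h4⟩, h2, h3 ▸ h4⟩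
    · rintro ⟨⟨h1, h2⟩, h3, h4⟩
      exact ⟨⟨⟨h1, h3⟩, h2.trans h4.symm⟩, h2⟩
  · intro q hq
    simp only [Finset.coe_filter, Finset.mem_product, Set.mem_ofPred_eq] at hq
    exact Finset.mem_coe.2 (Finset.mem_image₂_of_mem hq.1.1.1 hq.1.1.2)

noncomputable def MM (A : Finset ℝ) : Finset ℝ := Finset.image₂ (fun a b => a * (b + 1)) A A

lemma card_le_MM (A : Finset ℝ) (h1 : (-1 : ℝ) ∉ A) : A.card ≤ (MM A).card := by
  rcases A.eq_empty_or_nonempty with rfl | ⟨b, hb⟩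
  · simp
  · apply Finset.card_le_card_of_injOn (fun a => a * (b + 1))
    · intro a ha
      exact Finset.mem_coe.2 (Finset.mem_image₂_of_mem (f := fun a b : ℝ => a * (b + 1)) ha hb)
    · intro a _ a' _ h
      have : b + 1 ≠ 0 := fun h => h1 (by rwa [show (-1 : ℝ) = b by linarith])
      exact mul_right_cancel₀ this h

noncomputable def LL (A : Finset ℝ) : Finset (ℝ × ℝ) :=
  Finset.image₂ (fun m b => (1 / (m * b), 1 / m)) ((MM A).filter (· ≠ 0)) A

lemma LL_card (A : Finset ℝ) : (LL A).card ≤ (MM A).card * A.card :=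
  (Finset.card_image₂_le _ _ _).trans (Nat.mul_le_mul_right _ (Finset.card_filter_le _ _))

lemma LL_ne (A : Finset ℝ) (h0 : (0 : ℝ) ∉ A) : ∀ l ∈ LL A, l.1 ≠ 0 := by
  intro l hl
  obtain ⟨m, hm, b, hb, rfl⟩ := Finset.mem_image₂.1 hl
  have h2 : m ≠ 0 := (Finset.mem_filter.1 hm).2
  have h3 : b ≠ 0 := fun h => h0 (h ▸ hb)
  exact one_div_ne_zero (mul_ne_zero h2 h3)

lemma inc_lower (A S : Finset ℝ) (h0 : (0 : ℝ) ∉ A) (h1 : (-1 : ℝ) ∉ A) (D : ℝ)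
    (hS : ∀ s ∈ S, D ≤ rp A s) :
    (S.card : ℝ) * A.card * D ≤ (inc S (A.image (·⁻¹)) (LL A)).card := by
  classical
  have hY : (A.image (·⁻¹)).card = A.card := Finset.card_image_of_injective _ inv_injective
  have key : ∀ p ∈ S ×ˢ (A.image (·⁻¹)),
      D ≤ (((LL A).filter (fun l => p.2 = l.1 * p.1 + l.2)).card : ℝ) := by
    rintro ⟨x, y⟩ hp
    obtain ⟨hx, hy⟩ := Finset.mem_product.1 hp
    obtain ⟨c, hc, rfl⟩ := Finset.mem_image.1 hy
    refine (hS x hx).trans ?_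
    have hc0 : c ≠ 0 := fun h => h0 (h ▸ hc)
    norm_cast
    apply Finset.card_le_card_of_injOn
      (fun q => (1 / ((c * (q.1 + 1)) * q.2), 1 / (c * (q.1 + 1))))
    · rintro ⟨a, b⟩ hq
      simp only [Finset.coe_filter, Finset.mem_product, Set.mem_ofPred_eq] at hq
      obtain ⟨⟨ha, hb⟩, rfl⟩ := hq
      have ha1 : a + 1 ≠ 0 := fun h => h1 (by rwa [show (-1 : ℝ) = a by linarith])
      have hb0 : b ≠ 0 := fun h => h0 (h ▸ hb)
      refine Finset.mem_coe.2 (Finset.mem_filter.2 ⟨?_, ?_⟩)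
      · apply Finset.mem_image₂.2
        refine ⟨c * (a + 1), Finset.mem_filter.2 ⟨?_, mul_ne_zero hc0 ha1⟩, b, hb, rfl⟩
        exact Finset.mem_image₂.2 ⟨c, hc, a, ha, rfl⟩
      · dsimp only
        field_simp
    · rintro ⟨a, b⟩ hq ⟨a', b'⟩ hq' h
      simp only [Finset.coe_filter, Finset.mem_product, Set.mem_ofPred_eq, Prod.mk.injEq] at hq hq' h
      have e1 := h.2
      rw [one_div, one_div, inv_inj] at e1
      have e2 := mul_left_cancel₀ hc0 e1
      have e3 : a = a' := by linarith
      subst e3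
      have ha : a ≠ 0 := fun h => h0 (h ▸ hq.1.1)
      have : b = b' := mul_left_cancel₀ ha (hq.2.trans hq'.2.symm)
      rw [this]
  have hI : (inc S (A.image (·⁻¹)) (LL A)).card =
      ∑ p ∈ S ×ˢ (A.image (·⁻¹)), ((LL A).filter (fun l => p.2 = l.1 * p.1 + l.2)).card := by
    unfold inc
    rw [Finset.card_filter, Finset.sum_product]
    simp only [Finset.card_filter]
  rw [hI]
  push_cast
  have := Finset.card_nsmul_le_sum _ _ _ key
  rw [Finset.card_product, hY, nsmul_eq_mul] at this
  push_cast at this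
  exact this

lemma level (A S : Finset ℝ) (h0 : (0 : ℝ) ∉ A) (h1 : (-1 : ℝ) ∉ A) (D : ℝ) (hD : 0 < D)
    (hS : ∀ s ∈ S, D ≤ rp A s) (hSA : S ⊆ Finset.image₂ (· * ·) A A) :
    (S.card : ℝ) * D ^ 3 ≤ 68 * (MM A).card ^ 2 * A.card := by
  rcases S.eq_empty_or_nonempty with rfl | ⟨s0, hs0⟩
  · simp; positivity
  set n : ℝ := ((S.card : ℕ) : ℝ) with hn
  set m : ℝ := ((A.card : ℕ) : ℝ) with hm
  set M : ℝ := (((MM A).card : ℕ) : ℝ) with hM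
  have hDm : D ≤ m := (hS s0 hs0).trans (by rw [hm]; exact_mod_cast rp_le A h0 s0)
  have hmM : m ≤ M := by rw [hm, hM]; exact_mod_cast card_le_MM A h1
  have hm0 : 0 < m := hD.trans_le hDm
  have hM0 : 0 < M := hm0.trans_le hmM
  have hn0 : 0 < n := by
    have : 0 < S.card := Finset.card_pos.2 ⟨s0, hs0⟩
    rw [hn]; exact_mod_cast this
  have hnD : n * D ≤ m ^ 2 := by
    have e1 : n * D ≤ ∑ s ∈ S, (rp A s : ℝ) := by
      have := Finset.card_nsmul_le_sum S (fun s => (rp A s : ℝ)) D hS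
      rwa [nsmul_eq_mul] at this
    have e2 : ∑ s ∈ S, (rp A s : ℝ) ≤ ∑ s ∈ Finset.image₂ (· * ·) A A, (rp A s : ℝ) :=
      Finset.sum_le_sum_of_subset_of_nonneg hSA (fun _ _ _ => by positivity)
    have e3 : ∑ s ∈ Finset.image₂ (· * ·) A A, (rp A s : ℝ) = m ^ 2 := by
      rw [hm]; exact_mod_cast sum_rp A
    linarith
  set t : ℕ := ⌊16 * (M * m) / D ^ 2⌋₊ + 1 with ht
  have ht1 : 16 * (M * m) < t * D ^ 2 := by
    have := Nat.lt_floor_add_one (16 * (M * m) / D ^ 2)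
    rw [div_lt_iff₀ (by positivity)] at this
    rw [ht]; push_cast; exact this
  have hDD : D ^ 2 ≤ M * m := by nlinarith
  have ht2 : t * D ^ 2 ≤ 17 * (M * m) := by
    have := Nat.floor_le (a := 16 * (M * m) / D ^ 2) (by positivity)
    rw [le_div_iff₀ (by positivity)] at this
    rw [ht]; push_cast; linarith
  by_cases c1 : t ≤ S.card
  swap
  · have c1' : n ≤ t := by rw [hn]; exact_mod_cast (not_le.1 c1).le
    calc n * D ^ 3 ≤ t * D ^ 3 := by gcongr
      _ = t * D ^ 2 * D := by ring
      _ ≤ 17 * (M * m) * M := by gcongr; linarith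
      _ ≤ 68 * M ^ 2 * m := by
        have : 0 < M ^ 2 * m := by positivity
        linarith
  by_cases c2 : t ≤ A.card
  swap
  · have c2' : m ≤ t := by rw [hm]; exact_mod_cast (not_le.1 c2).le
    have e : m * D ^ 2 ≤ m * (17 * M) := by
      calc m * D ^ 2 ≤ t * D ^ 2 := by gcongr
        _ ≤ _ := ht2
        _ = _ := by ring
    calc n * D ^ 3 = (n * D) * D ^ 2 := by ring
      _ ≤ m ^ 2 * D ^ 2 := by gcongr
      _ = m * (m * D ^ 2) := by ring
      _ ≤ m * (m * (17 * M)) := by gcongr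
      _ ≤ m * (M * (17 * M)) := by gcongr
      _ ≤ 68 * M ^ 2 * m := by
        have : 0 < M ^ 2 * m := by positivity
        linarith
  have hY : (A.image (·⁻¹)).card = A.card := Finset.card_image_of_injective _ inv_injective
  have g := grid_ST S (A.image (·⁻¹)) (LL A) (LL_ne A h0) t (by omega) c1 (by rw [hY]; exact c2)
  have l := inc_lower A S h0 h1 D hS
  rw [hY, ← hn, ← hm] at g
  rw [← hn, ← hm] at l
  set I : ℝ := (((inc S (A.image (·⁻¹)) (LL A)).card : ℕ) : ℝ) with hI
  have hL : ((LL A).card : ℝ) ≤ M * m := by rw [hm, hM]; exact_mod_cast LL_card A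
  have ht0 : (0 : ℝ) < t := by rw [ht]; positivity
  have hI0 : 0 < I := lt_of_lt_of_le (by positivity) l
  have g2 : I ^ 2 ≤ 2 * (M * m) * t * (I + 4 * (n * m) ^ 2 / t ^ 2) := by
    refine g.trans ?_
    gcongr
  have hI2 : I ≤ 4 * (M * m) * t := by
    rcases le_total (4 * (n * m) ^ 2 / t ^ 2) I with h | h
    · have : I ^ 2 ≤ 2 * (M * m) * t * (I + I) := g2.trans (by gcongr)
      have : I * I ≤ (4 * (M * m) * t) * I := by linarith
      exact le_of_mul_le_mul_right this hI0
    · exfalso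
      have e1 : I ^ 2 ≤ 2 * (M * m) * t * (4 * (n * m) ^ 2 / t ^ 2 + 4 * (n * m) ^ 2 / t ^ 2) :=
        g2.trans (by gcongr)
      have e2 : 2 * (M * m) * t * (4 * (n * m) ^ 2 / t ^ 2 + 4 * (n * m) ^ 2 / t ^ 2)
        = 16 * (M * m) * (n * m) ^ 2 / t := by
        field_simp; ring
      rw [e2, le_div_iff₀ ht0] at e1
      have e3 : (n * m * D) ^ 2 ≤ I ^ 2 := by gcongr
      have e4 : (n * m * D) ^ 2 * t ≤ 16 * (M * m) * (n * m) ^ 2 :=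
        le_trans (by gcongr) e1
      have e5 : 16 * (M * m) * (n * m) ^ 2 < t * D ^ 2 * (n * m) ^ 2 := by gcongr
      linarith
  have f : n * m * D ≤ 4 * (M * m) * t := l.trans hI2
  have f2 : (n * D ^ 3) * m ≤ (68 * M ^ 2 * m) * m := by
    calc (n * D ^ 3) * m = (n * m * D) * D ^ 2 := by ring
      _ ≤ 4 * (M * m) * t * D ^ 2 := by gcongr
      _ = 4 * (M * m) * (t * D ^ 2) := by ring
      _ ≤ 4 * (M * m) * (17 * (M * m)) := by gcongr
      _ = _ := by ring
  exact le_of_mul_le_mul_right f2 hm0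

lemma dyadic {ι : Type*} (P : Finset ι) (r : ι → ℝ) (hr : ∀ s, 0 ≤ r s) (K : ℝ)
    (hK : ∀ D : ℝ, 0 < D → ((P.filter (fun s => D ≤ r s)).card : ℝ) * D ^ 3 ≤ K) (N : ℕ) :
    ∀ D : ℝ, 0 < D → ∑ s ∈ P.filter (fun s => D ≤ r s ∧ r s < 2 ^ N * D), r s ^ 2 ≤ 8 * K / D := by
  classical
  have hK0 : 0 ≤ K := le_trans (by positivity) (hK 1 one_pos)
  induction N with
  | zero =>
    intro D hD
    rw [Finset.filter_false_of_mem]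
    · simp; positivity
    · intro s _ h
      simp at h
      linarith
  | succ N ih =>
    intro D hD
    have hsub : P.filter (fun s => D ≤ r s ∧ r s < 2 ^ (N + 1) * D) ⊆
        P.filter (fun s => D ≤ r s ∧ r s < 2 * D) ∪
        P.filter (fun s => 2 * D ≤ r s ∧ r s < 2 ^ N * (2 * D)) := by
      intro s hs
      simp only [Finset.mem_union, Finset.mem_filter] at *
      rcases lt_or_ge (r s) (2 * D) with h | h
      · exact Or.inl ⟨hs.1, hs.2.1, h⟩
      · refine Or.inr ⟨hs.1, h, ?_⟩
        have := hs.2.2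
        rw [pow_succ] at this
        linarith
    have s1 : ∑ s ∈ P.filter (fun s => D ≤ r s ∧ r s < 2 * D), r s ^ 2 ≤ 4 * K / D := by
      have a1 : ∑ s ∈ P.filter (fun s => D ≤ r s ∧ r s < 2 * D), r s ^ 2 ≤
          (P.filter (fun s => D ≤ r s ∧ r s < 2 * D)).card • (2 * D) ^ 2 := by
        apply Finset.sum_le_card_nsmul
        intro s hs
        have := (Finset.mem_filter.1 hs).2.2
        have := hr s
        gcongr
      have a2 : ((P.filter (fun s => D ≤ r s ∧ r s < 2 * D)).card : ℝ) ≤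
          (P.filter (fun s => D ≤ r s)).card := by
        norm_cast
        apply Finset.card_le_card
        intro s hs
        simp only [Finset.mem_filter] at *
        exact ⟨hs.1, hs.2.1⟩
      have a3 := hK D hD
      rw [nsmul_eq_mul] at a1
      refine a1.trans ?_
      rw [le_div_iff₀ hD]
      calc _ ≤ ((P.filter (fun s => D ≤ r s)).card : ℝ) * (2 * D) ^ 2 * D := by gcongr
        _ = 4 * (((P.filter (fun s => D ≤ r s)).card : ℝ) * D ^ 3) := by ring
        _ ≤ _ := by linarith
    have s2 := ih (2 * D) (by positivity)
    have s3 : 8 * K / (2 * D) = 4 * K / D := by field_simp; ring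
    have s4 : 8 * K / D = 4 * K / D + 4 * K / D := by ring
    rw [s4]
    rw [s3] at s2
    have i1 := Finset.sum_le_sum_of_subset_of_nonneg (f := fun s => r s ^ 2) hsub
      (fun _ _ _ => by positivity)
    have i2 := Finset.sum_union_inter (f := fun s => r s ^ 2)
      (s₁ := P.filter (fun s => D ≤ r s ∧ r s < 2 * D))
      (s₂ := P.filter (fun s => 2 * D ≤ r s ∧ r s < 2 ^ N * (2 * D)))
    have i3 : 0 ≤ ∑ s ∈ P.filter (fun s => D ≤ r s ∧ r s < 2 * D) ∩
        P.filter (fun s => 2 * D ≤ r s ∧ r s < 2 ^ N * (2 * D)), r s ^ 2 :=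
      Finset.sum_nonneg (fun _ _ => by positivity)
    linarith

lemma split {ι : Type*} (P : Finset ι) (r : ι → ℝ) (hr : ∀ s, 0 ≤ r s) (K : ℝ)
    (hK : ∀ D : ℝ, 0 < D → ((P.filter (fun s => D ≤ r s)).card : ℝ) * D ^ 3 ≤ K)
    (B : ℝ) (hB : ∀ s, r s ≤ B) (D : ℝ) (hD : 0 < D) :
    ∑ s ∈ P, r s ^ 2 ≤ D ^ ((1 : ℝ) / 2) * ∑ s ∈ P, r s ^ ((3 : ℝ) / 2) + 8 * K / D := by
  classical
  obtain ⟨N, hN⟩ := pow_unbounded_of_one_lt (B / D) (one_lt_two)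
  rw [div_lt_iff₀ hD] at hN
  have d := dyadic P r hr K hK N D hD
  have e : P.filter (fun s => D ≤ r s ∧ r s < 2 ^ N * D) = P.filter (fun s => D ≤ r s) := by
    apply Finset.filter_congr
    intro s _
    exact ⟨fun h => h.1, fun h => ⟨h, (hB s).trans_lt hN⟩⟩
  rw [e] at d
  rw [← Finset.sum_filter_add_sum_filter_not P (fun s => D ≤ r s), add_comm]
  refine add_le_add ?_ d
  rw [Finset.mul_sum]
  refine le_trans (Finset.sum_le_sum (g := fun s => D ^ ((1 : ℝ) / 2) * r s ^ ((3 : ℝ) / 2)) ?_) ?_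
  · intro s hs
    have h : r s ≤ D := (not_le.1 (Finset.mem_filter.1 hs).2).le
    have : r s ^ 2 = r s ^ ((1 : ℝ) / 2) * r s ^ ((3 : ℝ) / 2) := by
      rw [← Real.rpow_add_of_nonneg (hr s) (by norm_num) (by norm_num), ← Real.rpow_natCast]
      norm_num
    rw [this]
    have := hr s
    gcongr
  · apply Finset.sum_le_sum_of_subset_of_nonneg (Finset.filter_subset _ _)
    intro s _ _
    have := hr s
    positivity

theorem stmt13 :
    ∃ C : ℝ, 0 < C ∧ ∀ A : Finset ℝ,
      (0 : ℝ) ∉ A → (1 : ℝ) ∉ A → (-1 : ℝ) ∉ A →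
      (E₂ A : ℝ) ≤
        C * ((Finset.image₂ (fun a b => a * (b + 1)) A A).card : ℝ) ^ ((2 : ℝ) / 3) *
          (A.card : ℝ) ^ ((1 : ℝ) / 3) * E₁₅ A ^ ((2 : ℝ) / 3) := by
  refine ⟨9 * 68 ^ ((1 : ℝ) / 3), by positivity, ?_⟩
  intro A h0 _ h1
  rcases A.eq_empty_or_nonempty with rfl | hA
  · simp [E₂]
  have hm0 : (0 : ℝ) < A.card := by exact_mod_cast hA.card_pos
  have hM0 : (0 : ℝ) < (MM A).card :=
    hm0.trans_le (by exact_mod_cast card_le_MM A h1)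
  change (E₂ A : ℝ) ≤ 9 * 68 ^ ((1 : ℝ) / 3) * ((MM A).card : ℝ) ^ ((2 : ℝ) / 3) *
          (A.card : ℝ) ^ ((1 : ℝ) / 3) * E₁₅ A ^ ((2 : ℝ) / 3)
  have hE : E₁₅ A = ∑ s ∈ Finset.image₂ (· * ·) A A, (rp A s : ℝ) ^ ((3 : ℝ) / 2) := rfl
  set E := E₁₅ A with hEdef
  have hE0 : 0 < E := by
    rw [hE]
    obtain ⟨a, ha⟩ := hA
    have hs : a * a ∈ Finset.image₂ (· * ·) A A := Finset.mem_image₂_of_mem ha ha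
    apply Finset.sum_pos' (fun _ _ => by positivity)
    refine ⟨a * a, hs, ?_⟩
    have : 0 < rp A (a * a) := Finset.card_pos.2 ⟨(a, a), by simp [ha]⟩
    positivity
  set K : ℝ := 68 * (MM A).card ^ 2 * A.card with hK
  have hK0 : 0 < K := by positivity
  have main := fun D hD => split (Finset.image₂ (· * ·) A A) (fun s => (rp A s : ℝ))
    (fun _ => by positivity) K
    (fun D hD => level A _ h0 h1 D hD (fun s hs => (Finset.mem_filter.1 hs).2)
      (Finset.filter_subset _ _)) A.card (fun s => by exact_mod_cast rp_le A h0 s) D hD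
  have hD0 : 0 < (K / E) ^ ((2 : ℝ) / 3) := by positivity
  have fin := main _ hD0
  rw [← hE] at fin
  have hE2 : (E₂ A : ℝ) = ∑ s ∈ Finset.image₂ (· * ·) A A, (rp A s : ℝ) ^ 2 := by
    rw [E₂_eq]; push_cast; rfl
  rw [← hE2] at fin
  have t1 : ((K / E) ^ ((2 : ℝ) / 3)) ^ ((1 : ℝ) / 2) * E = K ^ ((1 : ℝ) / 3) * E ^ ((2 : ℝ) / 3) := by
    rw [← Real.rpow_mul (by positivity), Real.div_rpow hK0.le hE0.le, div_mul_eq_mul_div,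
      div_eq_iff (by positivity), mul_assoc, ← Real.rpow_add hE0]
    norm_num
  have t2 : 8 * K / (K / E) ^ ((2 : ℝ) / 3) = 8 * (K ^ ((1 : ℝ) / 3) * E ^ ((2 : ℝ) / 3)) := by
    rw [Real.div_rpow hK0.le hE0.le, div_eq_iff (by positivity)]
    have : K ^ ((1 : ℝ) / 3) * K ^ ((2 : ℝ) / 3) = K := by
      rw [← Real.rpow_add hK0]; norm_num
    field_simp
    linarith
  have t3 : K ^ ((1 : ℝ) / 3) = 68 ^ ((1 : ℝ) / 3) * ((MM A).card : ℝ) ^ ((2 : ℝ) / 3) *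
      (A.card : ℝ) ^ ((1 : ℝ) / 3) := by
    rw [hK, Real.mul_rpow (by positivity) (by positivity),
      Real.mul_rpow (by positivity) (by positivity), ← Real.rpow_natCast,
      ← Real.rpow_mul (by positivity)]
    norm_num
  rw [t1, t2, t3] at fin
  linarith
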